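/- arXiv:0902.3013 — 2 statements merged into one kernel-verified Lean document; each statement's English description precedes it below -/
import Mathlib

section
/- Let A be a commutative noetherian ring with the property that A_p is Gorenstein for every non-maximal prime ideal p. If {F_i}_{i ∈ I} is a set-indexed family of N-totally acyclic cochain complexes of flat A-modules, then the degreewise product ∏_{i ∈ I} F_i is an N-totally acyclic complex of flat A-modules. In particular, an arbitrary product of Gorenstein flat A-modules is Gorenstein flat. -/
universe u

/-- A cochain complex `(X, d)` of flat `A`-modules is *N-totally acyclic* if it is acyclic
and `X ⊗_A I` is acyclic for every injective `A`-module `I`. -/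
def IsNTotallyAcyclic (A : Type u) [CommRing A] (X : ℤ → Type u)
    [∀ n, AddCommGroup (X n)] [∀ n, Module A (X n)]
    (d : ∀ n, X n →ₗ[A] X (n + 1)) : Prop :=
  (∀ n, Function.Exact (d n) (d (n + 1))) ∧
  ∀ (I : Type u) [AddCommGroup I] [Module A I], Module.Injective A I →
    ∀ n, Function.Exact (LinearMap.rTensor I (d n)) (LinearMap.rTensor I (d (n + 1)))

/-- An `R`-module `M` has finite injective dimension: there is a finite injective
coresolution `0 → M → I⁰ → I¹ → ⋯ → Iⁿ → 0`. -/
def HasFiniteInjectiveDimension (R : Type u) [CommRing R] (M : Type u) [AddCommGroup M]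
    [Module R M] : Prop :=
  ∃ (n : ℕ) (I : ℕ → Type u) (_ : ∀ j, AddCommGroup (I j)) (_ : ∀ j, Module R (I j))
    (ι : M →ₗ[R] I 0) (d : ∀ j, I j →ₗ[R] I (j + 1)),
    (∀ j, Module.Injective R (I j)) ∧ Function.Injective ι ∧ Function.Exact ι (d 0) ∧
    (∀ j, Function.Exact (d j) (d (j + 1))) ∧ ∀ j, n < j → Subsingleton (I j)

/-- A commutative noetherian ring is Gorenstein if each localization at a prime has finite
injective dimension over itself. -/
def IsGorensteinRing (A : Type u) [CommRing A] : Prop :=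
  ∀ (p : Ideal A) (_ : p.IsPrime),
    HasFiniteInjectiveDimension (Localization.AtPrime p) (Localization.AtPrime p)

/-- An `A`-module is Gorenstein flat if it is isomorphic to a syzygy
`Z^n(F) = ker (Fⁿ → Fⁿ⁺¹)` of an N-totally acyclic complex `F` of flat modules. -/
def IsGorensteinFlat (A : Type u) [CommRing A] (G : Type u) [AddCommGroup G]
    [Module A G] : Prop :=
  ∃ (X : ℤ → Type u) (_ : ∀ n, AddCommGroup (X n)) (_ : ∀ n, Module A (X n))
    (d : ∀ n, X n →ₗ[A] X (n + 1)),
    (∀ n, Module.Flat A (X n)) ∧ IsNTotallyAcyclic A X d ∧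
    ∃ n : ℤ, Nonempty (G ≃ₗ[A] ↥(LinearMap.ker (d n)))


section

open TensorProduct


theorem gf_ext_factor {R : Type u} [CommRing R] {I X Y : Type u} [AddCommGroup I] [Module R I]
    [AddCommGroup X] [Module R X] [AddCommGroup Y] [Module R Y] (hI : Module.Injective R I)
    (φ : X →ₗ[R] Y) (ψ : X →ₗ[R] I) (h : ∀ x, φ x = 0 → ψ x = 0) :
    ∃ χ : Y →ₗ[R] I, ∀ x, χ (φ x) = ψ x := by
  have hk : LinearMap.ker φ ≤ LinearMap.ker ψ := fun x hx => h x hx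
  obtain ⟨χ, hχ⟩ := hI.out ((LinearMap.ker φ).liftQ φ le_rfl)
    (LinearMap.ker_eq_bot.mp (Submodule.ker_liftQ_eq_bot _ _ _ le_rfl))
    ((LinearMap.ker φ).liftQ ψ hk)
  exact ⟨χ, fun x => by simpa using hχ (Submodule.Quotient.mk x)⟩

theorem gf_exists_rel {R : Type u} [CommRing R] [IsNoetherianRing R] {l : ℕ} (f : Fin l → R) :
    ∃ (c : ℕ) (κ : Fin c → Fin l → R), (∀ t, ∑ j, κ t j * f j = 0) ∧
      ∀ v : Fin l → R, ∑ j, v j * f j = 0 → ∃ a : Fin c → R, v = ∑ t, a t • κ t := by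
  let K : Submodule R (Fin l → R) := LinearMap.ker (Fintype.linearCombination R f)
  obtain ⟨c, κ, hκ⟩ := Submodule.fg_iff_exists_fin_generating_family.mp
    (IsNoetherian.noetherian K)
  refine ⟨c, κ, fun t => ?_, fun v hv => ?_⟩
  · have : κ t ∈ K := hκ ▸ Submodule.subset_span ⟨t, rfl⟩
    simpa [K, Fintype.linearCombination_apply] using this
  · have : v ∈ K := by simpa [K, Fintype.linearCombination_apply] using hv
    rw [← hκ, Submodule.mem_span_range_iff_exists_fun] at this
    obtain ⟨a, ha⟩ := this
    exact ⟨a, ha.symm⟩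

/-- the exactness `I → I^l → I^c`. -/
theorem gf_inj_exact {R : Type u} [CommRing R] {I : Type u} [AddCommGroup I] [Module R I]
    (hI : Module.Injective R I) {l c : ℕ} (f : Fin l → R) (κ : Fin c → Fin l → R)
    (h2 : ∀ v : Fin l → R, ∑ j, v j * f j = 0 → ∃ a : Fin c → R, v = ∑ t, a t • κ t)
    (v : Fin l → I) (hv : ∀ t, ∑ j, κ t j • v j = 0) : ∃ u : I, ∀ j, v j = f j • u := by
  obtain ⟨χ, hχ⟩ := gf_ext_factor hI (Fintype.linearCombination R f)
    (Fintype.linearCombination R v) (fun x hx => by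
      obtain ⟨a, rfl⟩ := h2 x (by simpa [Fintype.linearCombination_apply] using hx)
      rw [map_sum]
      refine Finset.sum_eq_zero fun t _ => ?_
      rw [map_smul, Fintype.linearCombination_apply, hv, smul_zero])
  refine ⟨χ 1, fun j => ?_⟩
  have := hχ (Pi.single j 1)
  simp only [Fintype.linearCombination_apply_single, one_smul] at this
  rw [← this, ← map_smul, smul_eq_mul, mul_one]

theorem gf_hom_flat {R : Type u} [CommRing R] [IsNoetherianRing R] {I E : Type u}
    [AddCommGroup I] [Module R I] [AddCommGroup E] [Module R E]
    (hI : Module.Injective R I) (hE : Module.Injective R E) : Module.Flat R (I →ₗ[R] E) := by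
  rw [Module.Flat.iff_forall_isTrivialRelation]
  intro l f x hx
  obtain ⟨c, κ, h1, h2⟩ := gf_exists_rel f
  let α : (Fin l → I) →ₗ[R] (Fin c → I) :=
    LinearMap.pi fun t => ∑ j, κ t j • LinearMap.proj j
  obtain ⟨y, hy⟩ := gf_ext_factor hE α (∑ j, x j ∘ₗ LinearMap.proj j) (fun v hv => by
    obtain ⟨u, hu⟩ := gf_inj_exact hI f κ h2 v (fun t => by
      have := congrFun hv t
      simpa [α] using this)
    have := LinearMap.congr_fun hx u
    simpa [hu] using this)
  refine ⟨c, fun j t => κ t j, fun t => y ∘ₗ LinearMap.single R (fun _ => I) t, ?_, ?_⟩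
  · intro j
    ext w
    have := hy (Pi.single j w)
    have h3 : (∑ j', x j' ∘ₗ LinearMap.proj j') (Pi.single j w : Fin l → I) = x j w := by
      simp only [LinearMap.coe_sum, Finset.sum_apply, LinearMap.comp_apply, LinearMap.proj_apply]
      rw [Finset.sum_eq_single j]
      · simp
      · intro b _ hb; simp [Pi.single_eq_of_ne hb]
      · simp
    rw [h3] at this
    rw [← this]
    have h4 : α (Pi.single j w) = ∑ t, κ t j • (Pi.single t w : Fin c → I) := by
      ext t
      simp only [α, LinearMap.pi_apply, LinearMap.coe_sum, Finset.sum_apply, LinearMap.smul_apply,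
        LinearMap.proj_apply, Pi.smul_apply]
      rw [Finset.sum_eq_single j, Finset.sum_eq_single t]
      · simp
      · intro b _ hb; simp [Pi.single_eq_of_ne hb.symm]
      · simp
      · intro b _ hb; simp [Pi.single_eq_of_ne hb]
      · simp
    rw [h4]
    simp
  · intro t
    rw [← h1 t]
    exact Finset.sum_congr rfl fun _ _ => mul_comm _ _

theorem gf_tensor_inj {R : Type u} [CommRing R] [IsNoetherianRing R] {P E : Type u}
    [AddCommGroup P] [Module R P] [AddCommGroup E] [Module R E]
    (hP : Module.Flat R P) (hE : Module.Injective R E) : Module.Injective R (P ⊗[R] E) := by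
  apply Module.Baer.injective
  intro 𝔞 F
  obtain ⟨b, f, hf⟩ := Submodule.fg_iff_exists_fin_generating_family.mp
    (IsNoetherian.noetherian 𝔞)
  obtain ⟨c, κ, h1, h2⟩ := gf_exists_rel f
  have hmem : ∀ j, f j ∈ 𝔞 := fun j => hf ▸ Submodule.subset_span ⟨j, rfl⟩
  let δ0 : E →ₗ[R] (Fin b → E) := LinearMap.pi fun j => f j • LinearMap.id
  let δ1 : (Fin b → E) →ₗ[R] (Fin c → E) :=
    LinearMap.pi fun t => ∑ j, κ t j • LinearMap.proj j
  have hex : Function.Exact δ0 δ1 := by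
    intro v
    constructor
    · intro hv
      obtain ⟨u, hu⟩ := gf_inj_exact hE f κ h2 v (fun t => by
        have := congrFun hv t
        simpa [δ1] using this)
      exact ⟨u, by ext j; simp [δ0, hu]⟩
    · rintro ⟨u, rfl⟩
      ext t
      have := congrArg (· • u) (h1 t)
      simpa [δ0, δ1, smul_smul, Finset.sum_smul] using this
  have hex' := Module.Flat.lTensor_exact P hex
  let eb := TensorProduct.piRight R R P (fun _ : Fin b => E)
  let ec := TensorProduct.piRight R R P (fun _ : Fin c => E)
  have hb : ∀ e j, eb (δ0.lTensor P e) j = f j • e := by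
    intro e j
    have : LinearMap.proj j ∘ₗ eb.toLinearMap ∘ₗ δ0.lTensor P = f j • LinearMap.id := by
      ext p e; simp [eb, δ0]
    exact LinearMap.congr_fun this e
  have hc : ∀ w t, ec (δ1.lTensor P w) t = ∑ j, κ t j • eb w j := by
    intro w t
    have : LinearMap.proj t ∘ₗ ec.toLinearMap ∘ₗ δ1.lTensor P
        = ∑ j, κ t j • (LinearMap.proj j ∘ₗ eb.toLinearMap) := by
      apply TensorProduct.ext'
      intro p e; simp [eb, ec, δ1, TensorProduct.tmul_sum]
    simpa using LinearMap.congr_fun this w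
  let w := eb.symm fun j => F ⟨f j, hmem j⟩
  have hw : δ1.lTensor P w = 0 := by
    apply ec.injective
    ext t
    rw [hc]
    simp only [w, LinearEquiv.apply_symm_apply, map_zero, Pi.zero_apply, ← map_smul, ← map_sum]
    convert F.map_zero
    ext
    simpa using h1 t
  obtain ⟨e, he⟩ := (hex' w).mp hw
  refine ⟨LinearMap.toSpanSingleton R _ e, fun x hx => ?_⟩
  have : F = LinearMap.toSpanSingleton R _ e ∘ₗ 𝔞.subtype := by
    have hs : Submodule.span R (Set.range fun j => (⟨f j, hmem j⟩ : 𝔞)) = ⊤ := by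
      apply Submodule.map_injective_of_injective 𝔞.injective_subtype
      rw [Submodule.map_span, ← Set.range_comp, Submodule.map_top, Submodule.range_subtype]
      exact hf
    apply LinearMap.ext_on_range hs
    intro j
    have := hb e j
    rw [he] at this
    simp only [w, LinearEquiv.apply_symm_apply] at this
    simpa using this
  rw [this]; rfl

theorem gf_inj_of_retract {R : Type u} [CommRing R] {J E : Type u} [AddCommGroup J] [Module R J]
    [AddCommGroup E] [Module R E] (hJ : Module.Injective R J) (i : E →ₗ[R] J) (r : J →ₗ[R] E)
    (h : ∀ e, r (i e) = e) : Module.Injective R E where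
  out X Y _ _ _ _ f hf g := by
    obtain ⟨k, hk⟩ := hJ.out f hf (i ∘ₗ g)
    exact ⟨r ∘ₗ k, fun x => by simp [hk, h]⟩

theorem gf_inj_of_equiv {R : Type u} [CommRing R] {J E : Type u} [AddCommGroup J] [Module R J]
    [AddCommGroup E] [Module R E] (hJ : Module.Injective R J) (e : J ≃ₗ[R] E) :
    Module.Injective R E :=
  gf_inj_of_retract hJ e.symm.toLinearMap e.toLinearMap (fun x => by simp)

theorem gf_inj_prod {R : Type u} [CommRing R] {J E : Type u} [AddCommGroup J] [Module R J]
    [AddCommGroup E] [Module R E] (hJ : Module.Injective R J) (hE : Module.Injective R E) :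
    Module.Injective R (J × E) where
  out X Y _ _ _ _ f hf g := by
    obtain ⟨k, hk⟩ := hJ.out f hf (LinearMap.fst R J E ∘ₗ g)
    obtain ⟨k', hk'⟩ := hE.out f hf (LinearMap.snd R J E ∘ₗ g)
    exact ⟨k.prod k', fun x => by ext <;> simp [hk, hk']⟩

/-- `x`-power torsion. -/
def gfT {R : Type u} [CommRing R] (x : R) (M : Type u) [AddCommGroup M] [Module R M] :
    Submodule R M where
  carrier := {m | ∃ k : ℕ, x ^ k • m = 0}
  zero_mem' := ⟨0, by simp⟩
  add_mem' := by
    rintro a b ⟨k, hk⟩ ⟨l, hl⟩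
    refine ⟨k + l, ?_⟩
    rw [smul_add, pow_add, mul_smul, mul_smul, hl, smul_zero, add_zero, smul_comm, hk, smul_zero]
  smul_mem' := by
    rintro r a ⟨k, hk⟩
    exact ⟨k, by rw [smul_comm, hk, smul_zero]⟩

theorem gf_mem_gfT {R : Type u} [CommRing R] {x : R} {M : Type u} [AddCommGroup M] [Module R M]
    {m : M} : m ∈ gfT x M ↔ ∃ k : ℕ, x ^ k • m = 0 := Iff.rfl

theorem gf_fg_torsion {R : Type u} [CommRing R] {x : R} {N M : Type u} [AddCommGroup M]
    [Module R M] [AddCommGroup N] [Module R N] [Module.Finite R N]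
    (f : N →ₗ[R] M) (h : ∀ n, f n ∈ gfT x M) : ∃ k : ℕ, ∀ n, x ^ k • f n = 0 := by
  obtain ⟨b, g, hg⟩ := Submodule.fg_iff_exists_fin_generating_family.mp
    (Module.Finite.fg_top (R := R) (M := N))
  choose k hk using fun j => h (g j)
  refine ⟨∑ j, k j, fun n => ?_⟩
  have : x ^ (∑ j, k j) • f = 0 := by
    apply LinearMap.ext_on_range hg
    intro j
    rw [LinearMap.smul_apply, LinearMap.zero_apply, ← Finset.sum_erase_add _ _ (Finset.mem_univ j),
      pow_add, mul_smul, hk, smul_zero]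
  exact LinearMap.congr_fun this n

theorem gfT_injective {R : Type u} [CommRing R] [IsNoetherianRing R] (x : R) {M : Type u}
    [AddCommGroup M] [Module R M] (hM : Module.Injective R M) :
    Module.Injective R (gfT x M) := by
  apply Module.Baer.injective
  intro 𝔞 f
  obtain ⟨k, hk⟩ := gf_fg_torsion (x := x) ((gfT x M).subtype ∘ₗ f) (fun n => (f n).2)
  obtain ⟨n, hn⟩ := Ideal.exists_pow_inf_eq_pow_smul (Ideal.span {x ^ k}) 𝔞
  have hAR : ∀ a : R, (x ^ k) ^ (n + 1) * a ∈ 𝔞 → ∃ a' ∈ 𝔞, (x ^ k) ^ (n + 1) * a = x ^ k * a' := by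
    intro a ha
    have h1 : (x ^ k) ^ (n + 1) * a ∈
        (Ideal.span {x ^ k} ^ (n + 1) • (⊤ : Ideal R) ⊓ 𝔞 : Ideal R) := by
      refine ⟨?_, ha⟩
      rw [Ideal.span_singleton_pow]
      exact Submodule.smul_mem_smul (Ideal.mem_span_singleton_self _) trivial
    rw [hn _ (Nat.le_succ n)] at h1
    have h2 : (x ^ k) ^ (n + 1) * a ∈ Ideal.span {x ^ k} * 𝔞 := by
      simp only [Nat.succ_eq_add_one, Nat.add_sub_cancel_left, pow_one] at h1
      exact Ideal.mul_mono_right inf_le_right h1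
    rw [Ideal.mem_span_singleton_mul] at h2
    obtain ⟨z, hz, h3⟩ := h2
    exact ⟨z, hz, h3.symm⟩
  obtain ⟨g0, hg0⟩ := Module.Baer.of_injective hM 𝔞 ((gfT x M).subtype ∘ₗ f)
  have hg1 : ∀ a, g0 a = a • g0 1 := fun a => by rw [← map_smul, smul_eq_mul, mul_one]
  set s := (x ^ k) ^ (n + 1) with hs
  obtain ⟨χ, hχ⟩ := gf_ext_factor hM (Submodule.mkQ 𝔞 ∘ₗ LinearMap.mulLeft R s)
    (g0 ∘ₗ LinearMap.mulLeft R s) (fun a ha => by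
      have : s * a ∈ 𝔞 := (Submodule.Quotient.mk_eq_zero 𝔞).mp ha
      obtain ⟨a', ha', h⟩ := hAR a this
      have h4 := hk ⟨a', ha'⟩
      simp only [LinearMap.comp_apply, LinearMap.mulLeft_apply]
      rw [h, ← smul_eq_mul, map_smul, hg0 a' ha']
      exact h4)
  let v := χ (Submodule.mkQ 𝔞 1)
  have hv1 : ∀ a, χ (Submodule.mkQ 𝔞 a) = a • v := fun a => by
    rw [← map_smul, ← map_smul, smul_eq_mul, mul_one]
  have hv2 : s • v = s • g0 1 := by
    rw [← hv1, ← hg1]; simpa using hχ 1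
  have hw : g0 1 - v ∈ gfT x M :=
    ⟨k * (n + 1), by rw [pow_mul, ← hs, smul_sub, hv2, sub_self]⟩
  refine ⟨LinearMap.toSpanSingleton R _ ⟨_, hw⟩, fun a ha => ?_⟩
  apply Subtype.ext
  have h5 : a • v = 0 := by
    rw [← hv1, Submodule.mkQ_apply, (Submodule.Quotient.mk_eq_zero 𝔞).mpr ha, map_zero]
  have h6 := hg0 a ha
  rw [hg1] at h6
  simp only [LinearMap.toSpanSingleton_apply, Submodule.coe_smul, smul_sub, h5, sub_zero, h6]
  rfl

theorem gf_div {R : Type u} [CommRing R] [IsNoetherianRing R] (x : R) {M : Type u}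
    [AddCommGroup M] [Module R M] (hM : Module.Injective R M) (k : ℕ) (w : M) :
    ∃ w' : M, w - x ^ k • w' ∈ gfT x M := by
  let f : ℕ →o Submodule R R :=
    ⟨fun n => LinearMap.ker (LinearMap.mulLeft R (x ^ n)), fun a b hab y hy => by
      obtain ⟨c, rfl⟩ := Nat.exists_eq_add_of_le hab
      simp only [LinearMap.mem_ker, LinearMap.mulLeft_apply] at hy ⊢
      rw [pow_add, mul_comm (x ^ a), mul_assoc, hy, mul_zero]⟩
  obtain ⟨N, hN⟩ := monotone_stabilizes_iff_noetherian.mpr (inferInstance : IsNoetherian R R) f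
  obtain ⟨χ, hχ⟩ := gf_ext_factor hM (LinearMap.mulLeft R (x ^ (N + k)))
    (LinearMap.toSpanSingleton R M (x ^ N • w)) (fun a ha => by
      have : a ∈ f (N + k) := ha
      rw [← hN _ (Nat.le_add_right N k)] at this
      have h : x ^ N * a = 0 := this
      rw [LinearMap.toSpanSingleton_apply, smul_smul, mul_comm, h, zero_smul])
  refine ⟨χ 1, N, ?_⟩
  have := hχ 1
  simp only [LinearMap.mulLeft_apply, mul_one, LinearMap.toSpanSingleton_apply, one_smul] at this
  rw [smul_sub, smul_smul, ← pow_add, ← this, ← map_smul, smul_eq_mul, mul_one, sub_self]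

theorem gf_hull {R : Type u} [CommRing R] {J : Type u} [AddCommGroup J] [Module R J]
    (hJ : Module.Injective R J) (N : Submodule R J) :
    ∃ E : Submodule R J, N ≤ E ∧ Module.Injective R E ∧ ∀ U ≤ E, Disjoint N U → U = ⊥ := by
  have zo : ∀ (N D : Submodule R J), Disjoint N D →
      ∃ C, D ≤ C ∧ Maximal (fun C => Disjoint N C) C := by
    intro N D hD
    refine zorn_le_nonempty₀ {C | Disjoint N C} (fun c hc hch y hy => ?_) D hD
    refine ⟨sSup c, ?_, fun z hz => le_sSup hz⟩
    exact (DirectedOn.disjoint_sSup_right hch.directedOn).mpr (fun b hb => hc hb)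
  obtain ⟨C, -, hC⟩ := zo N ⊥ disjoint_bot_right
  obtain ⟨E, hNE, hE⟩ := zo C N hC.prop.symm
  have hd := hE.prop
  obtain ⟨g, hg⟩ := gf_ext_factor hJ (C.mkQ ∘ₗ E.subtype) E.subtype (fun e he => by
    have h1 : (e : J) ∈ C := by simpa using he
    exact Submodule.disjoint_def.mp hd _ h1 e.2)
  have hg' : ∀ e ∈ E, g (C.mkQ e) = e := fun e he => hg ⟨e, he⟩
  have key : ∀ j, j ∉ C → ∃ r : R, ∃ n ∈ N, n ≠ 0 ∧ n = r • g (C.mkQ j) := by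
    intro j hj
    have h1 : ¬ Disjoint N (C ⊔ Submodule.span R {j}) := fun h => by
      have := hC.le_of_ge h le_sup_left
      exact hj (this (Submodule.mem_sup_right (Submodule.mem_span_singleton_self j)))
    rw [Submodule.disjoint_def] at h1
    push Not at h1
    obtain ⟨n, hn, hn2, hn0⟩ := h1
    obtain ⟨c, hc, y, hy, rfl⟩ := Submodule.mem_sup.mp hn2
    obtain ⟨r, rfl⟩ := Submodule.mem_span_singleton.mp hy
    refine ⟨r, _, hn, hn0, ?_⟩
    have h2 := hg' _ (hNE hn)
    have h3 : C.mkQ c = 0 := by simpa using hc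
    rw [map_add, h3, zero_add, map_smul, map_smul] at h2
    exact h2.symm
  have hr : ∀ j, g (C.mkQ j) ∈ E := by
    have h1 : Disjoint C (LinearMap.range (g ∘ₗ C.mkQ)) := by
      rw [Submodule.disjoint_def]
      rintro _ hc ⟨j, rfl⟩
      by_cases hj : j ∈ C
      · have h3 : C.mkQ j = 0 := by simpa using hj
        rw [LinearMap.comp_apply, h3, map_zero]
      · obtain ⟨r, n, hn, hn0, h⟩ := key j hj
        exact absurd (Submodule.disjoint_def.mp hC.prop n hn (h ▸ C.smul_mem r hc)) hn0
    have h2 := hE.le_of_ge h1 (fun e he => ⟨e, hg' e he⟩)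
    exact fun j => h2 ⟨j, rfl⟩
  refine ⟨E, hNE, gf_inj_of_retract hJ E.subtype ((g ∘ₗ C.mkQ).codRestrict E hr)
    (fun e => Subtype.ext (hg e)), fun U hU hNU => ?_⟩
  rw [eq_bot_iff]
  intro u hu
  by_cases huC : u ∈ C
  · exact Submodule.disjoint_def.mp hd u huC (hU hu)
  · obtain ⟨r, n, hn, hn0, h⟩ := key u huC
    rw [hg' u (hU hu)] at h
    exact absurd (Submodule.disjoint_def.mp hNU n hn (h ▸ U.smul_mem r hu)) hn0

theorem gf_inj_restrict {A R : Type u} [CommRing A] [CommRing R] [Algebra A R] [Module.Flat A R]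
    {I : Type u} [AddCommGroup I] [Module R I] [Module A I] [IsScalarTower A R I]
    (hI : Module.Injective R I) : Module.Injective A I := by
  apply Module.Baer.injective
  intro 𝔞 f
  have hinj : Function.Injective (LinearMap.baseChange R 𝔞.subtype) := by
    have := Module.Flat.lTensor_preserves_injective_linearMap (M := R) 𝔞.subtype
      𝔞.injective_subtype
    exact this
  obtain ⟨h, hh⟩ := hI.out (LinearMap.baseChange R 𝔞.subtype) hinj
    (LinearMap.liftBaseChange R f)
  refine ⟨(h.restrictScalars A) ∘ₗ (TensorProduct.mk A R A 1), fun x hx => ?_⟩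
  have := hh (1 ⊗ₜ ⟨x, hx⟩)
  simpa using this

theorem gf_comm {A : Type u} [CommRing A] {P Q M N : Type u} [AddCommGroup P] [Module A P]
    [AddCommGroup Q] [Module A Q] [AddCommGroup M] [Module A M] [AddCommGroup N] [Module A N]
    (d : P →ₗ[A] Q) (i : M →ₗ[A] N) (z : P ⊗[A] M) :
    d.rTensor N (i.lTensor P z) = i.lTensor Q (d.rTensor M z) := by
  rw [← LinearMap.comp_apply, ← LinearMap.comp_apply, LinearMap.rTensor_comp_lTensor,
    LinearMap.lTensor_comp_rTensor]

/-- comparison map of a tensor product with a product of modules -/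
noncomputable def gfTheta {A : Type u} [CommRing A] {ι : Type u} (P : ι → Type u)
    [∀ i, AddCommGroup (P i)] [∀ i, Module A (P i)] (N : Type u) [AddCommGroup N] [Module A N] :
    ((∀ i, P i) ⊗[A] N) →ₗ[A] (∀ i, P i ⊗[A] N) :=
  LinearMap.pi fun i => (LinearMap.proj i : (∀ i, P i) →ₗ[A] P i).rTensor N

theorem gfTheta_apply {A : Type u} [CommRing A] {ι : Type u} (P : ι → Type u)
    [∀ i, AddCommGroup (P i)] [∀ i, Module A (P i)] (N : Type u) [AddCommGroup N] [Module A N]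
    (z : (∀ i, P i) ⊗[A] N) (i : ι) :
    gfTheta P N z i = (LinearMap.proj i : (∀ i, P i) →ₗ[A] P i).rTensor N z := rfl

theorem gfTheta_lTensor {A : Type u} [CommRing A] {ι : Type u} (P : ι → Type u)
    [∀ i, AddCommGroup (P i)] [∀ i, Module A (P i)] {N M : Type u} [AddCommGroup N] [Module A N]
    [AddCommGroup M] [Module A M] (f : N →ₗ[A] M)
    (z : (∀ i, P i) ⊗[A] N) (i : ι) :
    gfTheta P M (f.lTensor _ z) i = f.lTensor _ (gfTheta P N z i) := by
  rw [gfTheta_apply, gfTheta_apply, gf_comm]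

theorem gfTheta_free {A : Type u} [CommRing A] {ι : Type u} (P : ι → Type u)
    [∀ i, AddCommGroup (P i)] [∀ i, Module A (P i)] (l : ℕ) :
    Function.Injective (gfTheta (A := A) P (Fin l → A)) := by
  rw [injective_iff_map_eq_zero]
  intro z hz
  apply (TensorProduct.piScalarRight A A (∀ i, P i) (Fin l)).injective
  rw [map_zero]
  ext j i
  have h : (TensorProduct.piScalarRight A A (P i) (Fin l)).toLinearMap ∘ₗ
      (LinearMap.proj i : (∀ i, P i) →ₗ[A] P i).rTensor (Fin l → A) =
      (LinearMap.pi fun j => LinearMap.proj i ∘ₗ LinearMap.proj j) ∘ₗ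
      (TensorProduct.piScalarRight A A (∀ i, P i) (Fin l)).toLinearMap := by
    apply TensorProduct.ext'
    intro p v
    ext j
    simp
  have h2 := congrFun (LinearMap.congr_fun h z) j
  have h3 := congrFun hz i
  rw [gfTheta_apply] at h3
  simp only [LinearMap.comp_apply, h3] at h2
  simpa using h2.symm

theorem gfTheta_surj {A : Type u} [CommRing A] {ι : Type u} (P : ι → Type u)
    [∀ i, AddCommGroup (P i)] [∀ i, Module A (P i)] (N : Type u) [AddCommGroup N] [Module A N]
    [Module.Finite A N] : Function.Surjective (gfTheta (A := A) P N) := by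
  intro y
  obtain ⟨l, π, hπ⟩ := Module.Finite.exists_fin' A N
  choose w hw using fun i => LinearMap.lTensor_surjective (P i) hπ (y i)
  let p : Fin l → ∀ i, P i := fun j i => TensorProduct.piScalarRight A A (P i) (Fin l) (w i) j
  refine ⟨π.lTensor _ ((TensorProduct.piScalarRight A A (∀ i, P i) (Fin l)).symm p), ?_⟩
  ext i
  rw [gfTheta_lTensor, ← hw i]
  congr 1
  apply (TensorProduct.piScalarRight A A (P i) (Fin l)).injective
  have h : (TensorProduct.piScalarRight A A (P i) (Fin l)).toLinearMap ∘ₗ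
      (LinearMap.proj i : (∀ i, P i) →ₗ[A] P i).rTensor (Fin l → A) =
      (LinearMap.pi fun j => LinearMap.proj i ∘ₗ LinearMap.proj j) ∘ₗ
      (TensorProduct.piScalarRight A A (∀ i, P i) (Fin l)).toLinearMap := by
    apply TensorProduct.ext'
    intro p v
    ext j
    simp
  have h2 := LinearMap.congr_fun h ((TensorProduct.piScalarRight A A (∀ i, P i) (Fin l)).symm p)
  rw [gfTheta_apply]
  simp only [LinearMap.comp_apply, LinearEquiv.coe_coe, LinearEquiv.apply_symm_apply] at h2
  rw [h2]
  ext j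
  simp [p]

theorem gfTheta_inj {A : Type u} [CommRing A] [IsNoetherianRing A] {ι : Type u} (P : ι → Type u)
    [∀ i, AddCommGroup (P i)] [∀ i, Module A (P i)] (N : Type u) [AddCommGroup N] [Module A N]
    [Module.Finite A N] : Function.Injective (gfTheta (A := A) P N) := by
  rw [injective_iff_map_eq_zero]
  intro z hz
  obtain ⟨l, π, hπ⟩ := Module.Finite.exists_fin' A N
  obtain ⟨z, rfl⟩ := LinearMap.lTensor_surjective _ hπ z
  have hex : Function.Exact (LinearMap.ker π).subtype π := LinearMap.exact_subtype_ker_map π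
  have h1 : ∀ i, ∃ k, (LinearMap.ker π).subtype.lTensor (P i) k = gfTheta P _ z i := by
    intro i
    apply (lTensor_exact (P i) hex hπ _).mp
    rw [← gfTheta_lTensor, hz]; rfl
  choose k hk using h1
  obtain ⟨k', rfl⟩ := gfTheta_surj P _ k
  have h2 : z = (LinearMap.ker π).subtype.lTensor _ k' := by
    apply gfTheta_free P l
    ext i
    rw [gfTheta_lTensor, hk]
  rw [h2]
  exact (lTensor_exact _ hex hπ _).mpr ⟨k', rfl⟩

theorem gf_flat_pi {A : Type u} [CommRing A] [IsNoetherianRing A] {ι : Type u} (P : ι → Type u)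
    [∀ i, AddCommGroup (P i)] [∀ i, Module A (P i)] (hP : ∀ i, Module.Flat A (P i)) :
    Module.Flat A (∀ i, P i) := by
  rw [Module.Flat.iff_lTensor_injective']
  intro 𝔞
  rw [injective_iff_map_eq_zero]
  intro z hz
  apply gfTheta_inj P
  rw [map_zero]
  ext i
  apply Module.Flat.lTensor_preserves_injective_linearMap (M := P i) 𝔞.subtype 𝔞.injective_subtype
  rw [← gfTheta_lTensor, hz]
  simp

/-- `X ⊗ M` is acyclic. -/
def gfGood {A : Type u} [CommRing A] (X : ℤ → Type u)
    [∀ n, AddCommGroup (X n)] [∀ n, Module A (X n)] (d : ∀ n, X n →ₗ[A] X (n + 1))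
    (M : Type u) [AddCommGroup M] [Module A M] : Prop :=
  ∀ n, Function.Exact ((d n).rTensor M) ((d (n + 1)).rTensor M)

section Good
variable {A : Type u} [CommRing A] {X : ℤ → Type u}
    [∀ n, AddCommGroup (X n)] [∀ n, Module A (X n)] {d : ∀ n, X n →ₗ[A] X (n + 1)}
    {M M' M'' : Type u} [AddCommGroup M] [Module A M] [AddCommGroup M'] [Module A M']
    [AddCommGroup M''] [Module A M'']

theorem gf_dd (hdd : ∀ n, Function.Exact (d n) (d (n + 1))) (n : ℤ) (z : X n ⊗[A] M) :
    (d (n + 1)).rTensor M ((d n).rTensor M z) = 0 := by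
  rw [← LinearMap.comp_apply, ← LinearMap.rTensor_comp, (hdd n).linearMap_comp_eq_zero,
    LinearMap.rTensor_zero, LinearMap.zero_apply]

theorem gf_good_of (hdd : ∀ n, Function.Exact (d n) (d (n + 1)))
    (h : ∀ n (z : X (n + 1) ⊗[A] M), (d (n + 1)).rTensor M z = 0 →
      ∃ y, (d n).rTensor M y = z) : gfGood X d M := by
  intro n z
  refine ⟨h n z, ?_⟩
  rintro ⟨y, rfl⟩
  exact gf_dd hdd n y

theorem gf_good_flat (hdd : ∀ n, Function.Exact (d n) (d (n + 1))) [Module.Flat A M] :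
    gfGood X d M := fun n => Module.Flat.rTensor_exact M (hdd n)

theorem gf_good_ext (hdd : ∀ n, Function.Exact (d n) (d (n + 1)))
    (hX : ∀ n, Module.Flat A (X n)) (i : M' →ₗ[A] M) (q : M →ₗ[A] M'')
    (hi : Function.Injective i) (hiq : Function.Exact i q) (hq : Function.Surjective q)
    (h' : gfGood X d M') (h'' : gfGood X d M'') : gfGood X d M := by
  apply gf_good_of hdd
  intro n z hz
  obtain ⟨y, hy⟩ := (h'' n (q.lTensor _ z)).mp (by rw [gf_comm, hz, map_zero])
  obtain ⟨y, rfl⟩ := LinearMap.lTensor_surjective _ hq y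
  obtain ⟨v, hv⟩ := (lTensor_exact (X (n + 1)) hiq hq (z - (d n).rTensor M y)).mp (by
    rw [map_sub, ← gf_comm, hy, sub_self])
  obtain ⟨t, rfl⟩ := (h' n v).mp (by
    apply Module.Flat.lTensor_preserves_injective_linearMap (M := X (n + 1 + 1)) i hi
    rw [← gf_comm, hv, map_sub, hz, gf_dd hdd, sub_self, map_zero])
  exact ⟨y + i.lTensor _ t, by rw [map_add, gf_comm, hv]; abel⟩

theorem gf_good_quot (hdd : ∀ n, Function.Exact (d n) (d (n + 1)))
    (hX : ∀ n, Module.Flat A (X n)) (i : M' →ₗ[A] M) (q : M →ₗ[A] M'')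
    (hi : Function.Injective i) (hiq : Function.Exact i q) (hq : Function.Surjective q)
    (h' : gfGood X d M') (h : gfGood X d M) : gfGood X d M'' := by
  apply gf_good_of hdd
  intro n z hz
  obtain ⟨u, rfl⟩ := LinearMap.lTensor_surjective _ hq z
  obtain ⟨v, hv⟩ := (lTensor_exact (X (n + 1 + 1)) hiq hq ((d (n + 1)).rTensor M u)).mp (by
    rw [← gf_comm, hz])
  obtain ⟨t, rfl⟩ := (h' (n + 1) v).mp (by
    apply Module.Flat.lTensor_preserves_injective_linearMap (M := X (n + 1 + 1 + 1)) i hi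
    rw [← gf_comm, hv, gf_dd hdd, map_zero])
  obtain ⟨w, hw⟩ := (h n (u - i.lTensor _ t)).mp (by
    rw [map_sub, gf_comm, hv, sub_self])
  refine ⟨q.lTensor _ w, ?_⟩
  rw [gf_comm, hw, map_sub, (lTensor_exact _ hiq hq _).mpr ⟨t, rfl⟩, sub_zero]

theorem gf_good_union (hdd : ∀ n, Function.Exact (d n) (d (n + 1)))
    (hX : ∀ n, Module.Flat A (X n))
    (h : ∀ N : Submodule A M, N.FG → ∃ T : Submodule A M, N ≤ T ∧ gfGood X d T) :
    gfGood X d M := by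
  apply gf_good_of hdd
  intro n z hz
  obtain ⟨N, hN, z, rfl⟩ : ∃ (N : Submodule A M), N.FG ∧ ∃ z',
      N.subtype.lTensor (X (n + 1)) z' = z := by
    obtain ⟨N, hN, y, hy⟩ := Submodule.exists_fg_le_eq_rTensor_subtype
      (TensorProduct.comm A _ _ z)
    refine ⟨N, hN, TensorProduct.comm A _ _ y, ?_⟩
    rw [← LinearMap.comm_comp_rTensor_comp_comm_eq]
    simp [← hy]
  obtain ⟨T, hNT, hT⟩ := h N hN
  have e : N.subtype = T.subtype ∘ₗ Submodule.inclusion hNT := rfl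
  rw [e, LinearMap.lTensor_comp, LinearMap.comp_apply] at hz ⊢
  rw [gf_comm] at hz
  obtain ⟨y, hy⟩ := (hT n _).mp (Module.Flat.lTensor_preserves_injective_linearMap
    (M := X (n + 1 + 1)) T.subtype T.injective_subtype (hz.trans (map_zero _).symm))
  exact ⟨T.subtype.lTensor _ y, by rw [gf_comm, hy]⟩

theorem gf_good_equiv (hdd : ∀ n, Function.Exact (d n) (d (n + 1)))
    (hX : ∀ n, Module.Flat A (X n)) (e : M' ≃ₗ[A] M) (h : gfGood X d M') : gfGood X d M := by
  refine gf_good_quot hdd hX (M' := PUnit.{u+1}) (0 : PUnit.{u+1} →ₗ[A] M') e.toLinearMap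
    (fun _ _ _ => rfl) ?_ e.surjective (gf_good_flat hdd) h
  intro x
  constructor
  · intro hx; exact ⟨0, by rw [(e.map_eq_zero_iff).mp hx]; rfl⟩
  · rintro ⟨y, rfl⟩; simp
end Good

theorem gf_case_gor {A : Type u} [CommRing A] [IsNoetherianRing A] {X : ℤ → Type u}
    [∀ n, AddCommGroup (X n)] [∀ n, Module A (X n)] {d : ∀ n, X n →ₗ[A] X (n + 1)}
    (hdd : ∀ n, Function.Exact (d n) (d (n + 1))) (hX : ∀ n, Module.Flat A (X n))
    {R : Type u} [CommRing R] [Algebra A R] [Module.Flat A R]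
    (hR : HasFiniteInjectiveDimension R R)
    {E : Type u} [AddCommGroup E] [Module A E] (hE : Module.Injective A E)
    (ht : ∀ r : R, ∃ s a : A, algebraMap A R s * r = algebraMap A R a ∧
      ∀ e : E, s • e = 0 → e = 0)
    (hk : ∀ a : A, algebraMap A R a = 0 → ∀ e : E, a • e = 0) : gfGood X d E := by
  obtain ⟨n, I, _, _, ι, D, hI, hι, hιD, hD, hs⟩ := hR
  let _ : ∀ j, Module A (I j) := fun j => Module.compHom _ (algebraMap A R)
  have : ∀ j, IsScalarTower A R (I j) := fun j => IsScalarTower.of_algebraMap_smul fun _ _ => rfl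
  have hIA : ∀ j, Module.Injective A (I j) := fun j => gf_inj_restrict (R := R) (hI j)
  let D' : ∀ j, I j →ₗ[A] I (j + 1) := fun j => (D j).restrictScalars A
  let δ : ∀ j, (I (j + 1) →ₗ[A] E) →ₗ[A] (I j →ₗ[A] E) := fun j => LinearMap.lcomp A E (D' j)
  have hfl : ∀ j, Module.Flat A (I j →ₗ[A] E) := fun j => gf_hom_flat (hIA j) hE
  have claim : ∀ k j, n ≤ j + k → gfGood X d (LinearMap.range (δ j)) := by
    intro k
    induction k with
    | zero =>
      intro j hj
      have := hs (j + 1) (by omega)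
      have : Subsingleton (I (j + 1) →ₗ[A] E) :=
        ⟨fun f g => by ext x; rw [Subsingleton.elim x 0, map_zero, map_zero]⟩
      have : Subsingleton (LinearMap.range (δ j)) :=
        (δ j).surjective_rangeRestrict.subsingleton
      exact gf_good_flat hdd
    | succ k ih =>
      intro j hj
      refine gf_good_quot hdd hX (LinearMap.range (δ (j + 1))).subtype (δ j).rangeRestrict
        (Submodule.injective_subtype _) ?_ (δ j).surjective_rangeRestrict
        (ih (j + 1) (by omega)) (gf_good_flat hdd)
      intro h
      constructor
      · intro hh
        have hh' : δ j h = 0 := congrArg Subtype.val hh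
        obtain ⟨χ, hχ⟩ := gf_ext_factor hE (D' (j + 1)) h (fun x hx => by
          obtain ⟨y, rfl⟩ := (hD j x).mp hx
          exact LinearMap.congr_fun hh' y)
        exact ⟨⟨h, ⟨χ, by ext x; exact hχ x⟩⟩, rfl⟩
      · rintro ⟨⟨_, ⟨χ, rfl⟩⟩, rfl⟩
        apply Subtype.ext
        ext x
        change χ (D (j + 1) (D j x)) = 0
        rw [(hD j).apply_apply_eq_zero, map_zero]
  let q : (I 0 →ₗ[A] E) →ₗ[A] E := LinearMap.applyₗ (ι 1)
  have hιa : ∀ a : A, ι (algebraMap A R a) = a • ι 1 := fun a => by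
    rw [Algebra.algebraMap_eq_smul_one, ← algebraMap_smul R a (1 : R), map_smul, algebraMap_smul]
  refine gf_good_quot hdd hX (LinearMap.range (δ 0)).subtype q
        (Submodule.injective_subtype _) ?_ ?_
        (claim n 0 (by omega)) (gf_good_flat hdd)
  · intro h
    constructor
    · intro hh
      have hh' : h (ι 1) = 0 := hh
      obtain ⟨χ, hχ⟩ := gf_ext_factor hE (D' 0) h (fun x hx => by
          obtain ⟨r, rfl⟩ := (hιD x).mp hx
          obtain ⟨s, a, h1, h2⟩ := ht r
          apply h2
          rw [← map_smul, ← algebraMap_smul R s (ι r), ← map_smul, smul_eq_mul, h1, hιa,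
            map_smul, hh', smul_zero])
      exact ⟨⟨h, ⟨χ, by ext x; exact hχ x⟩⟩, rfl⟩
    · rintro ⟨⟨_, ⟨χ, rfl⟩⟩, rfl⟩
      change χ (D 0 (ι 1)) = 0
      rw [hιD.apply_apply_eq_zero, map_zero]
  · intro e
    obtain ⟨χ, hχ⟩ := gf_ext_factor hE (LinearMap.toSpanSingleton A (I 0) (ι 1))
      (LinearMap.toSpanSingleton A E e) (fun a ha => by
        rw [LinearMap.toSpanSingleton_apply, ← hιa] at ha
        exact hk a (hι (ha.trans (map_zero ι).symm)) e)
    exact ⟨χ, show χ (ι 1) = e by simpa using hχ 1⟩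

/-- iterated torsion -/
def gfTL {R : Type u} [CommRing R] (M : Type u) [AddCommGroup M] [Module R M] :
    List R → Submodule R M
  | [] => ⊤
  | x :: l => gfTL M l ⊓ gfT x M

theorem gf_mem_gfTL {R : Type u} [CommRing R] {M : Type u} [AddCommGroup M] [Module R M]
    (l : List R) (m : M) : m ∈ gfTL M l ↔ ∀ x ∈ l, m ∈ gfT x M := by
  induction l with
  | nil => simp [gfTL]
  | cons x l ih => simp [gfTL, ih, and_comm]

theorem gf_torsion_exact {A : Type u} [CommRing A] [IsNoetherianRing A] {Y : ℤ → Type u}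
    [∀ n, AddCommGroup (Y n)] [∀ n, Module A (Y n)] {d : ∀ n, Y n →ₗ[A] Y (n + 1)}
    (hdd : ∀ n, Function.Exact (d n) (d (n + 1))) (hY : ∀ n, Module.Injective A (Y n))
    (l : List A) :
    (∀ n, Module.Injective A (gfTL (R := A) (Y n) l)) ∧
    ∀ n, ∀ z ∈ gfTL (R := A) (Y (n + 1)) l, d (n + 1) z = 0 →
      ∃ y ∈ gfTL (R := A) (Y n) l, d n y = z := by
  induction l with
  | nil =>
    refine ⟨fun n => gf_inj_of_equiv (hY n) Submodule.topEquiv.symm, fun n z _ hz => ?_⟩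
    obtain ⟨y, hy⟩ := (hdd n z).mp hz
    exact ⟨y, trivial, hy⟩
  | cons x l ih =>
    obtain ⟨ih1, ih2⟩ := ih
    have hdT : ∀ n, ∀ y ∈ gfTL (R := A) (Y n) l, d n y ∈ gfTL (R := A) (Y (n + 1)) l := by
      intro n y hy
      rw [gf_mem_gfTL] at hy ⊢
      intro x hx
      obtain ⟨k, hk⟩ := hy x hx
      exact ⟨k, by rw [← map_smul, hk, map_zero]⟩
    constructor
    · intro n
      have h1 := gfT_injective x (ih1 n)
      have h2 : gfTL (R := A) (Y n) (x :: l) =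
          (gfT x (gfTL (R := A) (Y n) l)).map (gfTL (R := A) (Y n) l).subtype := by
        ext y
        constructor
        · rintro ⟨hy1, k, hk⟩
          exact ⟨⟨y, hy1⟩, ⟨k, Subtype.ext hk⟩, rfl⟩
        · rintro ⟨y, ⟨k, hk⟩, rfl⟩
          exact ⟨y.2, ⟨k, congrArg Subtype.val hk⟩⟩
      rw [h2]
      exact gf_inj_of_equiv h1 (Submodule.equivSubtypeMap _ _)
    · have main : ∀ n, ∀ z ∈ gfTL (R := A) (Y (n + 1 + 1)) (x :: l), d (n + 1 + 1) z = 0 →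
          ∃ y ∈ gfTL (R := A) (Y (n + 1)) (x :: l), d (n + 1) y = z := by
        rintro n z ⟨hz1, k, hk⟩ hz
        obtain ⟨y, hy, rfl⟩ := ih2 (n + 1) z hz1 hz
        obtain ⟨w, hw, hwy⟩ := ih2 n (x ^ k • y) (Submodule.smul_mem _ _ hy)
          (by rw [map_smul, hk])
        obtain ⟨w', N, hN⟩ := gf_div x (ih1 n) k ⟨w, hw⟩
        have hN' : x ^ N • (w - x ^ k • (w' : Y n)) = 0 := congrArg Subtype.val hN
        refine ⟨y - d n w', ⟨Submodule.sub_mem _ hy (hdT n _ w'.2), N + k, ?_⟩, ?_⟩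
        · rw [pow_add, mul_smul, smul_sub (x ^ k), ← hwy, ← map_smul, ← map_sub, ← map_smul, hN',
            map_zero]
        · rw [map_sub, (hdd n).apply_apply_eq_zero, sub_zero]
      intro n
      have := main (n - 1)
      rw [sub_add_cancel] at this
      exact this

/-- common kernel of the `k`th powers -/
def gfKer {R : Type u} [CommRing R] (M : Type u) [AddCommGroup M] [Module R M]
    (l : List R) (k : ℕ) : Submodule R M where
  carrier := {m | ∀ x ∈ l, x ^ k • m = 0}
  zero_mem' := fun x _ => smul_zero _
  add_mem' := fun ha hb x hx => by rw [smul_add, ha x hx, hb x hx, add_zero]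
  smul_mem' := fun r a ha x hx => by rw [smul_comm, ha x hx, smul_zero]

theorem gf_ker_fg_one {R : Type u} [CommRing R] [IsNoetherianRing R] {M : Type u}
    [AddCommGroup M] [Module R M] (x : R) (W : Submodule R M)
    (h : (W ⊓ gfKer M [x] 1).FG) (k : ℕ) : (W ⊓ gfKer M [x] k).FG := by
  induction k with
  | zero =>
    refine h.of_le (inf_le_inf_left _ fun m hm y hy => ?_)
    have := hm y hy
    rw [pow_zero, one_smul] at this
    rw [this, smul_zero]
  | succ k ih =>
    apply Submodule.fg_of_fg_map_of_fg_inf_ker (LinearMap.lsmul R M x)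
    · refine ih.of_le ?_
      rintro _ ⟨m, ⟨hm1, hm2⟩, rfl⟩
      refine ⟨W.smul_mem x hm1, fun y hy => ?_⟩
      rw [List.mem_singleton] at hy
      subst hy
      have := hm2 y (by simp)
      rwa [pow_succ, mul_smul] at this
    · refine h.of_le ?_
      rintro m ⟨⟨hm1, hm2⟩, hm3⟩
      refine ⟨hm1, fun y hy => ?_⟩
      rw [List.mem_singleton] at hy
      subst hy
      rw [pow_one]
      exact hm3

theorem gf_ker_fg {R : Type u} [CommRing R] [IsNoetherianRing R] {M : Type u}
    [AddCommGroup M] [Module R M] (l : List R) (k : ℕ) : ∀ (W : Submodule R M)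
    (_ : (W ⊓ gfKer M l 1).FG), (W ⊓ gfKer M l k).FG := by
  induction l with
  | nil =>
    intro W h
    refine h.of_le (inf_le_inf_left _ fun m _ y hy => ?_)
    simp at hy
  | cons x l ih =>
    intro W h
    have h1 := gf_ker_fg_one x (W ⊓ gfKer M l 1) (h.of_le (by
      rintro m ⟨⟨hm1, hm2⟩, hm3⟩
      refine ⟨hm1, fun y hy => ?_⟩
      rcases List.mem_cons.mp hy with rfl | hy
      · exact hm3 _ (by simp)
      · exact hm2 _ hy)) k
    have h2 := ih (W ⊓ gfKer M [x] k) (h1.of_le (by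
      rintro m ⟨⟨hm1, hm2⟩, hm3⟩
      exact ⟨⟨hm1, hm3⟩, hm2⟩))
    refine h2.of_le ?_
    rintro m ⟨hm1, hm2⟩
    refine ⟨⟨hm1, fun y hy => ?_⟩, fun y hy => hm2 y (by simp [hy])⟩
    rw [List.mem_singleton] at hy
    exact hm2 y (by simp [hy])

theorem gf_ker_tensor {R : Type u} [CommRing R] {P E : Type u}
    [AddCommGroup P] [Module R P] [AddCommGroup E] [Module R E]
    (hP : Module.Flat R P) (l : List R) (k : ℕ) (z : P ⊗[R] E)
    (hz : ∀ x ∈ l, x ^ k • z = 0) : ∃ z', (gfKer E l k).subtype.lTensor P z' = z := by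
  let ρ : E →ₗ[R] (Fin l.length → E) := LinearMap.pi fun j => (l.get j) ^ k • LinearMap.id
  have hex : Function.Exact (gfKer E l k).subtype ρ := by
    intro e
    constructor
    · intro he
      refine ⟨⟨e, fun x hx => ?_⟩, rfl⟩
      obtain ⟨j, rfl⟩ := List.mem_iff_get.mp hx
      exact congrFun he j
    · rintro ⟨e, rfl⟩
      ext j
      exact e.2 _ (List.get_mem _ _)
  apply (Module.Flat.lTensor_exact P hex z).mp
  apply (TensorProduct.piRight R R P (fun _ : Fin l.length => E)).injective
  ext j
  have : LinearMap.proj j ∘ₗ (TensorProduct.piRight R R P (fun _ : Fin l.length => E)).toLinearMap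
      ∘ₗ ρ.lTensor P = (l.get j) ^ k • LinearMap.id := by
    apply TensorProduct.ext'
    intro p e; simp [ρ]
  have h2 := LinearMap.congr_fun this z
  rw [LinearMap.smul_apply, LinearMap.id_apply, hz _ (List.get_mem _ _)] at h2
  simpa using h2

theorem gf_common_exp {R : Type u} [CommRing R] {M : Type u}
    [AddCommGroup M] [Module R M] (l : List R) (y : M) (h : ∀ x ∈ l, y ∈ gfT x M) :
    ∃ k : ℕ, ∀ x ∈ l, x ^ k • y = 0 := by
  induction l with
  | nil => exact ⟨0, by simp⟩
  | cons x l ih =>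
    obtain ⟨k, hk⟩ := ih fun x hx => h x (by simp [hx])
    obtain ⟨k', hk'⟩ := h x (by simp)
    refine ⟨k + k', fun y hy => ?_⟩
    rcases List.mem_cons.mp hy with rfl | hy
    · rw [pow_add, mul_smul, hk', smul_zero]
    · rw [pow_add, mul_comm, mul_smul, hk y hy, smul_zero]

theorem gf_exists_fg {A : Type u} [CommRing A] {P M : Type u} [AddCommGroup P] [Module A P]
    [AddCommGroup M] [Module A M] (z : P ⊗[A] M) :
    ∃ (N : Submodule A M), N.FG ∧ ∃ z', N.subtype.lTensor P z' = z := by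
  obtain ⟨N, hN, y, hy⟩ := Submodule.exists_fg_le_eq_rTensor_subtype
    (TensorProduct.comm A _ _ z)
  refine ⟨N, hN, TensorProduct.comm A _ _ y, ?_⟩
  rw [← LinearMap.comm_comp_rTensor_comp_comm_eq]
  simp [← hy]

theorem gfTheta_inj' {A : Type u} [CommRing A] [IsNoetherianRing A] {ι : Type u} (P : ι → Type u)
    [∀ i, AddCommGroup (P i)] [∀ i, Module A (P i)] (hP : ∀ i, Module.Flat A (P i))
    (M : Type u) [AddCommGroup M] [Module A M] : Function.Injective (gfTheta (A := A) P M) := by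
  rw [injective_iff_map_eq_zero]
  intro z hz
  obtain ⟨N, hN, z, rfl⟩ := gf_exists_fg z
  have : Module.Finite A N := Module.Finite.iff_fg.mpr hN
  have : z = 0 := by
    apply gfTheta_inj P
    rw [map_zero]
    ext i
    apply Module.Flat.lTensor_preserves_injective_linearMap (M := P i) N.subtype N.injective_subtype
    rw [← gfTheta_lTensor, hz]
    simp
  rw [this, map_zero]

theorem gf_case_max {A : Type u} [CommRing A] [IsNoetherianRing A] {ι : Type u}
    {F : ι → ℤ → Type u} [∀ i n, AddCommGroup (F i n)] [∀ i n, Module A (F i n)]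
    {d : ∀ i n, F i n →ₗ[A] F i (n + 1)} (hF : ∀ i n, Module.Flat A (F i n))
    (hdd : ∀ i n, Function.Exact (d i n) (d i (n + 1)))
    {E : Type u} [AddCommGroup E] [Module A E] (hE : Module.Injective A E)
    (hG : ∀ i, gfGood (F i) (d i) E) (l : List A) (hl : ∀ x ∈ l, ∀ e : E, e ∈ gfT x E)
    (hs : (gfKer E l 1).FG)
    (hdd' : ∀ n, Function.Exact (LinearMap.pi fun i => (d i n) ∘ₗ LinearMap.proj i :
        (∀ i, F i n) →ₗ[A] (∀ i, F i (n + 1)))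
      (LinearMap.pi fun i => (d i (n + 1)) ∘ₗ LinearMap.proj i)) :
    gfGood (fun n => ∀ i, F i n) (fun n => LinearMap.pi fun i => (d i n) ∘ₗ LinearMap.proj i) E := by
  apply gf_good_of hdd'
  intro n z hz
  let D : ∀ n, (∀ i, F i n ⊗[A] E) →ₗ[A] (∀ i, F i (n + 1) ⊗[A] E) := fun n =>
    LinearMap.pi fun i => (d i n).rTensor E ∘ₗ LinearMap.proj i
  have hD : ∀ n, Function.Exact (D n) (D (n + 1)) := by
    intro n y
    constructor
    · intro hy
      choose w hw using fun i => (hG i n (y i)).mp (congrFun hy i)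
      exact ⟨w, funext hw⟩
    · rintro ⟨w, rfl⟩
      ext i
      exact (hG i n _).mpr ⟨w i, rfl⟩
  have hinj : ∀ n, Module.Injective A (∀ i, F i n ⊗[A] E) := fun n => by
    have := fun i => gf_tensor_inj (hF i n) hE
    infer_instance
  have hθ : ∀ n (y : (∀ i, F i n) ⊗[A] E), gfTheta (fun i => F i (n + 1)) E
      ((LinearMap.pi fun i => (d i n) ∘ₗ LinearMap.proj i :
        (∀ i, F i n) →ₗ[A] (∀ i, F i (n + 1))).rTensor E y) = D n (gfTheta (fun i => F i n) E y) := by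
    intro n y
    ext i
    simp only [gfTheta_apply, D, LinearMap.pi_apply, LinearMap.comp_apply, LinearMap.proj_apply]
    rw [← LinearMap.comp_apply, ← LinearMap.comp_apply, ← LinearMap.rTensor_comp,
      ← LinearMap.rTensor_comp]
    rfl
  have htor : ∀ x ∈ l, ∀ y : (∀ i, F i (n + 1)) ⊗[A] E, y ∈ gfT x ((∀ i, F i (n + 1)) ⊗[A] E) := by
    intro x hx y
    induction y using TensorProduct.induction_on with
    | zero => exact Submodule.zero_mem _
    | add a b ha hb => exact Submodule.add_mem _ ha hb
    | tmul p e =>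
      obtain ⟨k, hk⟩ := hl x hx e
      exact ⟨k, by rw [← TensorProduct.tmul_smul, hk, TensorProduct.tmul_zero]⟩
  obtain ⟨y, hy, hyz⟩ := (gf_torsion_exact hD hinj l).2 n
    (gfTheta (fun i => F i (n + 1)) E z) (by
      rw [gf_mem_gfTL]
      intro x hx
      obtain ⟨k, hk⟩ := htor x hx z
      exact ⟨k, by rw [← map_smul, hk, map_zero]⟩) (by
      rw [← hθ, hz, map_zero])
  rw [gf_mem_gfTL] at hy
  obtain ⟨k, hk⟩ := gf_common_exp l y hy
  choose w hw using fun i => gf_ker_tensor (hF i n) l k (y i) (fun x hx => congrFun (hk x hx) i)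
  have : Module.Finite A (gfKer E l k) := Module.Finite.iff_fg.mpr (by
    have := gf_ker_fg l k ⊤ (by simpa using hs)
    simpa using this)
  obtain ⟨w, rfl⟩ := gfTheta_surj (fun i => F i n) _ w
  refine ⟨(gfKer E l k).subtype.lTensor _ w, ?_⟩
  apply gfTheta_inj' (fun i => F i (n + 1)) (fun i => hF i (n + 1)) E
  rw [hθ, ← hyz]
  congr 1
  ext i
  rw [gfTheta_lTensor, hw]

theorem gf_devissage {A : Type u} [CommRing A] [IsNoetherianRing A] {X : ℤ → Type u}
    [∀ n, AddCommGroup (X n)] [∀ n, Module A (X n)] {d : ∀ n, X n →ₗ[A] X (n + 1)}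
    (hdd : ∀ n, Function.Exact (d n) (d (n + 1))) (hX : ∀ n, Module.Flat A (X n))
    {I : Type u} [AddCommGroup I] [Module A I] (hI : Module.Injective A I)
    (h : ∀ (E : Submodule A I) (c : I) (p : Ideal A), c ∈ E → p.IsPrime →
      (∀ a : A, a • c = 0 ↔ a ∈ p) → Module.Injective A E →
      (∀ U ≤ E, Disjoint (Submodule.span A {c}) U → U = ⊥) → gfGood X d E) :
    gfGood X d I := by
  apply gf_good_union hdd hX
  intro N hN
  have : IsNoetherian A N := isNoetherian_of_fg_of_noetherian N hN
  obtain ⟨K, ⟨T, hT1, hT2, rfl⟩, hmax⟩ := set_has_maximal_iff_noetherian.mpr this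
    {K : Submodule A N | ∃ T : Submodule A I, Module.Injective A T ∧ gfGood X d T ∧
      K = T.comap N.subtype} ⟨_, ⊥, by
        refine ⟨⟨fun X Y _ _ _ _ f hf g => ⟨0, fun x => Subsingleton.elim _ _⟩⟩,
          gf_good_flat hdd, rfl⟩⟩
  refine ⟨T, ?_, hT2⟩
  by_contra hNT
  obtain ⟨n, hn, hnT⟩ := Set.not_subset.mp hNT
  obtain ⟨r, hr⟩ := hT1.out T.subtype T.injective_subtype LinearMap.id
  have hr' : ∀ t ∈ T, (r t : I) = t := fun t ht => congrArg Subtype.val (hr ⟨t, ht⟩)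
  let q : N →ₗ[A] I := (LinearMap.id - T.subtype ∘ₗ r) ∘ₗ N.subtype
  have hq : ∀ x, q x = (x : I) - (r x : I) := fun x => rfl
  have hne : (⟨q ⟨n, hn⟩, ⟨_, rfl⟩⟩ : LinearMap.range q) ≠ 0 := by
    intro h0
    have h1 : q ⟨n, hn⟩ = 0 := congrArg Subtype.val h0
    rw [hq, sub_eq_zero] at h1
    apply hnT
    change n ∈ T
    have h2 : n = (r n : I) := h1
    rw [h2]; exact (r n).2
  obtain ⟨p, hp, -⟩ := exists_le_isAssociatedPrime_of_isNoetherianRing A _ hne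
  obtain ⟨hp, ⟨_, ⟨n', rfl⟩⟩, hpc⟩ := isAssociatedPrime_iff.mp hp
  set c := q n' with hc
  have hann : ∀ a : A, a • c = 0 ↔ a ∈ p := by
    intro a
    rw [hpc, Submodule.mem_colon_singleton, Submodule.mem_bot, ← Subtype.coe_inj]
    rfl
  have hrc : r c = 0 := by
    apply Subtype.ext
    rw [hc, hq, map_sub, Submodule.coe_sub, hr' _ (r (n' : I)).2, sub_self]; rfl
  obtain ⟨E, hcE, hE1, hE2⟩ := gf_hull hI (Submodule.span A {c})
  have hcE' : c ∈ E := hcE (Submodule.mem_span_singleton_self c)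
  have hEg := h E c p hcE' hp hann hE1 hE2
  have hET : E ⊓ T = ⊥ := by
    apply hE2 _ inf_le_left
    rw [Submodule.disjoint_def]
    rintro x hx ⟨-, hxT⟩
    obtain ⟨a, rfl⟩ := Submodule.mem_span_singleton.mp hx
    rw [← hr' _ hxT, map_smul, hrc, smul_zero]; rfl
  let φ : (T × E) →ₗ[A] I := T.subtype.coprod E.subtype
  have hφ : Function.Injective φ := by
    rw [injective_iff_map_eq_zero]
    rintro ⟨t, e⟩ hte
    have hte' : (t : I) + e = 0 := hte
    have h1 : (e : I) ∈ E ⊓ T := ⟨e.2, by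
      rw [eq_neg_of_add_eq_zero_right hte']; exact T.neg_mem t.2⟩
    rw [hET, Submodule.mem_bot] at h1
    rw [h1, add_zero] at hte'
    exact Prod.ext (Subtype.ext hte') (Subtype.ext h1)
  have eφ := LinearEquiv.ofInjective φ hφ
  have hgood : gfGood X d (T × E) := by
    refine gf_good_ext hdd hX (LinearMap.inl A T E) (LinearMap.snd A T E) LinearMap.inl_injective
      ?_ LinearMap.snd_surjective hT2 hEg
    exact Function.Exact.inl_snd
  refine hmax _ ⟨LinearMap.range φ, gf_inj_of_equiv (gf_inj_prod hT1 hE1) eφ,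
    gf_good_equiv hdd hX eφ hgood, rfl⟩ ?_
  refine lt_of_le_not_ge (Submodule.comap_mono fun t ht => ⟨(⟨t, ht⟩, 0), by simp [φ]⟩) ?_
  intro hle
  have h1 : n' ∈ (LinearMap.range φ).comap N.subtype :=
    ⟨(r n', ⟨c, hcE'⟩), by simp [φ, hc, hq]⟩
  have h2 : (n' : I) ∈ T := hle h1
  have h3 : c = 0 := by rw [hc, hq, hr' _ h2, sub_self]
  exact hp.ne_top ((Ideal.eq_top_iff_one p).mpr ((hann 1).mp (by rw [h3, smul_zero])))

theorem gf_prod_good {A : Type u} [CommRing A] [IsNoetherianRing A]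
    (hGor : ∀ (p : Ideal A) (_ : p.IsPrime), ¬ p.IsMaximal →
      HasFiniteInjectiveDimension (Localization.AtPrime p) (Localization.AtPrime p)) {ι : Type u}
    {F : ι → ℤ → Type u} [∀ i n, AddCommGroup (F i n)] [∀ i n, Module A (F i n)]
    {d : ∀ i n, F i n →ₗ[A] F i (n + 1)} (hF : ∀ i n, Module.Flat A (F i n))
    (hN : ∀ i, IsNTotallyAcyclic A (F i) (d i)) :
    IsNTotallyAcyclic A (fun n => ∀ i, F i n)
          (fun n => LinearMap.pi fun i => (d i n) ∘ₗ LinearMap.proj i) := by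
  have hdd' : ∀ n, Function.Exact (LinearMap.pi fun i => (d i n) ∘ₗ LinearMap.proj i :
        (∀ i, F i n) →ₗ[A] (∀ i, F i (n + 1)))
      (LinearMap.pi fun i => (d i (n + 1)) ∘ₗ LinearMap.proj i) := by
    intro n y
    constructor
    · intro hy
      choose w hw using fun i => ((hN i).1 n (y i)).mp (congrFun hy i)
      exact ⟨w, funext hw⟩
    · rintro ⟨w, rfl⟩
      ext i
      exact ((hN i).1 n _).mpr ⟨w i, rfl⟩
  refine ⟨hdd', ?_⟩
  intro I _ _ hI
  refine gf_devissage hdd' (fun n => gf_flat_pi _ fun i => hF i n) hI ?_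
  intro E c p hcE hp hann hE hess
  have hreg : ∀ s : A, s ∉ p → ∀ e : E, s • e = 0 → e = 0 := by
    intro s hs e he
    have h1 : Submodule.span A {(e : I)} = ⊥ := by
      apply hess
      · rw [Submodule.span_singleton_le_iff_mem]; exact e.2
      · rw [Submodule.disjoint_def]
        intro x hx hx'
        obtain ⟨a, rfl⟩ := Submodule.mem_span_singleton.mp hx
        obtain ⟨b, hb⟩ := Submodule.mem_span_singleton.mp hx'
        have h2 : s • a • c = 0 := by
          rw [← hb, smul_comm, show s • (e : I) = 0 from congrArg Subtype.val he, smul_zero]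
        rw [smul_smul, hann] at h2
        exact (hann a).mpr ((hp.mem_or_mem h2).resolve_left hs)
    exact Subtype.ext (Submodule.span_singleton_eq_bot.mp h1)
  by_cases hm : p.IsMaximal
  · obtain ⟨S, hS⟩ := IsNoetherian.noetherian p
    refine gf_case_max hF (fun i => (hN i).1) hE (fun i => (hN i).2 E hE) S.toList ?_ ?_ hdd'
    · intro x hx e
      have hxp : x ∈ p := hS ▸ Submodule.subset_span (by simpa using hx)
      obtain ⟨r, hr⟩ := (gfT_injective x hE).out (gfT x E).subtype (Submodule.injective_subtype _)
        LinearMap.id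
      have hr' : ∀ t ∈ gfT x E, (r t : E) = t := fun t ht => congrArg Subtype.val (hr ⟨t, ht⟩)
      have hcT : (⟨c, hcE⟩ : E) ∈ gfT x E :=
        ⟨1, Subtype.ext (by rw [pow_one]; exact (hann x).mpr hxp)⟩
      have h1 : (LinearMap.ker r).map E.subtype = ⊥ := by
        apply hess _ (Submodule.map_subtype_le _ _)
        rw [Submodule.disjoint_def]
        rintro y hy ⟨k, hk, rfl⟩
        obtain ⟨a, ha⟩ := Submodule.mem_span_singleton.mp hy
        have hka : k = a • (⟨c, hcE⟩ : E) := Subtype.ext ha.symm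
        have h2 : k ∈ gfT x E := hka ▸ Submodule.smul_mem _ _ hcT
        rw [← hr' k h2, LinearMap.mem_ker.mp hk]; rfl
      have h3 : (e - (r e : E)) ∈ LinearMap.ker r := by
        rw [LinearMap.mem_ker, map_sub]
        apply Subtype.ext
        rw [Submodule.coe_sub, hr' _ (r e).2, sub_self]; rfl
      have h4 : E.subtype (e - (r e : E)) ∈ (LinearMap.ker r).map E.subtype := ⟨_, h3, rfl⟩
      rw [h1, Submodule.mem_bot] at h4
      have h5 : e = (r e : E) := sub_eq_zero.mp (Subtype.ext h4)
      rw [h5]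
      exact (r e).2
    · refine (Submodule.fg_span_singleton (R := A) (⟨c, hcE⟩ : E)).of_le ?_
      intro e he
      by_cases he0 : e = 0
      · rw [he0]; exact Submodule.zero_mem _
      have hpe : ∀ x ∈ p, x • e = 0 := by
        intro x hx
        rw [← hS] at hx
        induction hx using Submodule.span_induction with
        | mem y hy => simpa using he y (by simpa using hy)
        | zero => exact zero_smul _ _
        | add a b _ _ ha hb => rw [add_smul, ha, hb, add_zero]
        | smul a b _ hb => rw [smul_assoc, hb, smul_zero]
      have h1 : ¬ Disjoint (Submodule.span A {c}) (Submodule.span A {(e : I)}) := fun hd => by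
        have := hess _ (by rw [Submodule.span_singleton_le_iff_mem]; exact e.2) hd
        exact he0 (Subtype.ext (Submodule.span_singleton_eq_bot.mp this))
      rw [Submodule.disjoint_def] at h1
      push Not at h1
      obtain ⟨y, hy1, hy2, hy0⟩ := h1
      obtain ⟨a, rfl⟩ := Submodule.mem_span_singleton.mp hy1
      obtain ⟨b, hb⟩ := Submodule.mem_span_singleton.mp hy2
      have hbp : b ∉ p := fun hb' => hy0 (by
        rw [← hb]; exact congrArg Subtype.val (hpe b hb'))
      obtain ⟨b', i, hi, h2⟩ := hm.exists_inv hbp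
      have h3 : e = b' • b • e := by
        conv_lhs => rw [← one_smul A e, ← h2, add_smul, hpe i hi, add_zero, mul_smul]
      have h4 : b • e = a • (⟨c, hcE⟩ : E) := Subtype.ext hb
      rw [h3, h4]
      exact Submodule.smul_mem _ _ (Submodule.smul_mem _ _ (Submodule.mem_span_singleton_self _))
  · have hfl : Module.Flat A (Localization.AtPrime p) :=
      IsLocalization.flat (Localization.AtPrime p) p.primeCompl
    refine gf_case_gor (R := Localization.AtPrime p) hdd'
      (fun n => gf_flat_pi _ fun i => hF i n) (hGor p hp hm) hE ?_ ?_
    · intro r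
      obtain ⟨⟨a, s⟩, h⟩ := IsLocalization.surj p.primeCompl r
      exact ⟨s, a, by rw [mul_comm]; exact h, hreg s s.2⟩
    · intro a ha e
      obtain ⟨s, hs⟩ := (IsLocalization.map_eq_zero_iff p.primeCompl (Localization.AtPrime p) a).mp ha
      apply hreg s s.2
      rw [smul_smul, hs, zero_smul]

def gfD {A : Type u} [CommRing A] {X : ℤ → Type u}
    [∀ n, AddCommGroup (X n)] [∀ n, Module A (X n)]
    (d : ∀ n, X n →ₗ[A] X (n + 1)) (m m' : ℤ) (h : m' = m + 1) : X m →ₗ[A] X m' :=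
  h ▸ d m

theorem gf_shift {A : Type u} [CommRing A] {G : Type u} [AddCommGroup G] [Module A G]
    (hG : IsGorensteinFlat A G) :
    ∃ (X : ℤ → Type u) (_ : ∀ n, AddCommGroup (X n)) (_ : ∀ n, Module A (X n))
    (d : ∀ n, X n →ₗ[A] X (n + 1)),
    (∀ n, Module.Flat A (X n)) ∧ IsNTotallyAcyclic A X d ∧
    Nonempty (G ≃ₗ[A] ↥(LinearMap.ker (d 0))) := by
  obtain ⟨X, i1, i2, d, hf, hN, k, ⟨e⟩⟩ := hG
  have hex : ∀ m m' m'' (h : m' = m + 1) (h' : m'' = m' + 1),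
      Function.Exact (gfD d m m' h) (gfD d m' m'' h') := by
    intro m m' m'' h h'
    subst h; subst h'
    exact hN.1 m
  have hexT : ∀ (I : Type u) [AddCommGroup I] [Module A I], Module.Injective A I →
      ∀ m m' m'' (h : m' = m + 1) (h' : m'' = m' + 1),
      Function.Exact (LinearMap.rTensor I (gfD d m m' h))
        (LinearMap.rTensor I (gfD d m' m'' h')) := by
    intro I _ _ hI m m' m'' h h'
    subst h; subst h'
    exact hN.2 I hI m
  have hk : ∀ m m' (h : m' = m + 1), k = m →
      Nonempty (G ≃ₗ[A] ↥(LinearMap.ker (gfD d m m' h))) := by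
    intro m m' h hm
    subst hm; subst h
    exact ⟨e⟩
  refine ⟨fun n => X (n + k), fun n => i1 _, fun n => i2 _,
    fun n => gfD d (n + k) (n + 1 + k) (by ring), fun n => hf _, ⟨?_, ?_⟩, ?_⟩
  · intro n; exact hex _ _ _ _ _
  · intro I _ _ hI n; exact hexT I hI _ _ _ _ _
  · exact hk _ _ _ (by simp)

theorem gf_prod_gflat {A : Type u} [CommRing A] [IsNoetherianRing A]
    (hGor : ∀ (p : Ideal A) (_ : p.IsPrime), ¬ p.IsMaximal →
      HasFiniteInjectiveDimension (Localization.AtPrime p) (Localization.AtPrime p)) {ι : Type u}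
    (G : ι → Type u) [∀ i, AddCommGroup (G i)] [∀ i, Module A (G i)]
    (hG : ∀ i, IsGorensteinFlat A (G i)) : IsGorensteinFlat A (∀ i, G i) := by
  choose X i1 i2 d hf hN he using fun i => gf_shift (hG i)
  refine ⟨fun n => ∀ i, X i n, inferInstance, inferInstance,
    fun n => LinearMap.pi fun i => (d i n) ∘ₗ LinearMap.proj i,
    fun n => gf_flat_pi _ fun i => hf i n, gf_prod_good hGor hf hN, 0, ⟨?_⟩⟩
  let e := fun i => (he i).some
  let φ : (∀ i, G i) →ₗ[A] (∀ i, X i 0) :=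
    LinearMap.pi fun i => (LinearMap.ker (d i 0)).subtype ∘ₗ (e i).toLinearMap ∘ₗ LinearMap.proj i
  have hφ : ∀ g, φ g ∈ LinearMap.ker
      (LinearMap.pi fun i => (d i 0) ∘ₗ LinearMap.proj i :
        (∀ i, X i 0) →ₗ[A] ∀ i, X i (0 + 1)) := by
    intro g
    rw [LinearMap.mem_ker]
    funext i
    exact LinearMap.mem_ker.mp (e i (g i)).2
  refine LinearEquiv.ofBijective (φ.codRestrict _ hφ) ⟨?_, ?_⟩
  · intro a b hab
    funext i
    apply (e i).injective
    apply Subtype.ext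
    exact congrFun (congrArg Subtype.val hab) i
  · rintro ⟨x, hx⟩
    have hx' : ∀ i, x i ∈ LinearMap.ker (d i 0) := fun i =>
      LinearMap.mem_ker.mpr (congrFun (LinearMap.mem_ker.mp hx) i)
    refine ⟨fun i => (e i).symm ⟨x i, hx' i⟩, ?_⟩
    apply Subtype.ext
    funext i
    change ((e i ((e i).symm ⟨x i, hx' i⟩) : LinearMap.ker (d i 0)) : X i 0) = x i
    rw [LinearEquiv.apply_symm_apply]

end

/-- Over a commutative noetherian ring whose localization at every non-maximal prime is
Gorenstein, a product of N-totally acyclic complexes of flat modules is N-totally acyclic; in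
particular a product of Gorenstein flat modules is Gorenstein flat. -/
theorem prod_nTotallyAcyclic_and_prod_gorensteinFlat
    (A : Type u) [CommRing A] [IsNoetherianRing A]
    (hGor : ∀ (p : Ideal A) (_ : p.IsPrime), ¬ p.IsMaximal →
      HasFiniteInjectiveDimension (Localization.AtPrime p) (Localization.AtPrime p)) :
    (∀ (ι : Type u) (F : ι → ℤ → Type u) (_ : ∀ i n, AddCommGroup (F i n))
        (_ : ∀ i n, Module A (F i n)) (d : ∀ i n, F i n →ₗ[A] F i (n + 1)),
        (∀ i n, Module.Flat A (F i n)) →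
        (∀ i, IsNTotallyAcyclic A (F i) (d i)) →
        IsNTotallyAcyclic A (fun n => ∀ i, F i n)
          (fun n => LinearMap.pi fun i => (d i n) ∘ₗ LinearMap.proj i)) ∧
    (∀ (ι : Type u) (G : ι → Type u) (_ : ∀ i, AddCommGroup (G i)) (_ : ∀ i, Module A (G i)),
        (∀ i, IsGorensteinFlat A (G i)) → IsGorensteinFlat A (∀ i, G i)) := by
  exact ⟨fun ι F _ _ d hF hN => gf_prod_good hGor hF hN,
    fun ι G _ _ hG => gf_prod_gflat hGor G hG⟩
end

section
/- Let A be a commutative ring, E an injective cogenerator of the category of A-modules, and F any A-module. Then the canonical evaluation map α : F → Hom_A(Hom_A(F, E), E) is a pure monomorphism. -/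
universe u

/-- `E` is an injective cogenerator of the category of `A`-modules. -/
def IsInjectiveCogenerator (A : Type u) [CommRing A] (E : Type u) [AddCommGroup E]
    [Module A E] : Prop :=
  Module.Injective A E ∧
    ∀ (M : Type u) [AddCommGroup M] [Module A M], (∀ f : M →ₗ[A] E, f = 0) → Subsingleton M

/-- The canonical evaluation map `F → Hom_A(Hom_A(F, E), E)`, `x ↦ (g ↦ g x)`. -/
noncomputable def evalMap (A : Type u) [CommRing A] (F E : Type u) [AddCommGroup F] [Module A F]
    [AddCommGroup E] [Module A E] : F →ₗ[A] ((F →ₗ[A] E) →ₗ[A] E) :=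
  (LinearMap.id : (F →ₗ[A] E) →ₗ[A] (F →ₗ[A] E)).flip

theorem sep_aux (A : Type u) [CommRing A] (E : Type u) [AddCommGroup E] [Module A E]
    (hE : IsInjectiveCogenerator A E) (M : Type u) [AddCommGroup M] [Module A M] (x : M)
    (hx : ∀ f : M →ₗ[A] E, f x = 0) : x = 0 := by
  obtain ⟨hinj, hcog⟩ := hE
  have hs : Subsingleton (Submodule.span A {x}) := by
    apply hcog
    intro f
    obtain ⟨g, hg⟩ := hinj.out (Submodule.span A {x}).subtype
      (Submodule.subtype_injective _) f
    ext ⟨y, hy⟩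
    obtain ⟨a, rfl⟩ := Submodule.mem_span_singleton.1 hy
    rw [← hg]
    simp [hx g]
  have h := Subsingleton.elim
    (⟨x, Submodule.mem_span_singleton_self x⟩ : Submodule.span A {x}) 0
  exact congrArg Subtype.val h

/-- For any module `F` over a commutative ring `A` and any injective cogenerator `E`, the
evaluation map `α : F → Hom_A(Hom_A(F, E), E)` is a pure monomorphism. -/
theorem evalMap_pure_monomorphism
    (A : Type u) [CommRing A]
    (E : Type u) [AddCommGroup E] [Module A E] (hE : IsInjectiveCogenerator A E)
    (F : Type u) [AddCommGroup F] [Module A F] :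
    Function.Injective (evalMap A F E) ∧
    ∀ (L : Type u) [AddCommGroup L] [Module A L],
      Function.Injective (LinearMap.rTensor L (evalMap A F E)) := by
  refine ⟨?_, ?_⟩
  · rw [injective_iff_map_eq_zero]
    intro x hx
    exact sep_aux A E hE F x fun f => LinearMap.congr_fun hx f
  · intro L _ _
    rw [injective_iff_map_eq_zero]
    intro z hz
    refine sep_aux A E hE _ z fun h => ?_
    let k := TensorProduct.lift
      ((LinearMap.lcomp A E (TensorProduct.mk A F L |>.compr₂ h).flip) :
        ((F →ₗ[A] E) →ₗ[A] E) →ₗ[A] (L →ₗ[A] E))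
    have hk : k ∘ₗ LinearMap.rTensor L (evalMap A F E) = h := by
      ext x l
      rfl
    rw [← hk, LinearMap.comp_apply, hz, map_zero]
end
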